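/- arXiv:2209.03114 — 3 statements merged into one kernel-verified Lean document; each statement's English description precedes it below -/
import Mathlib

section
/- Let v₀ ∈ ℝ³ be a fixed nonzero vector, m₊, m₋ ∈ ℝ, and consider the two-centre (Euler) Hamiltonian J(u,v) = ‖u‖²/2 − m₊/‖v+v₀‖ − m₋/‖v−v₀‖ on the open set of (u,v) ∈ ℝ³×ℝ³ with v ≠ v₀ and v ≠ −v₀. Then the Euler integral E(u,v) = ‖v×u‖² + (v₀·u)² + 2(v·v₀)(m₊/‖v+v₀‖ − m₋/‖v−v₀‖) is a first integral of J, i.e. the Poisson bracket {J, E} vanishes identically on this set. -/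
open Matrix

/-- Partial gradient component in the momentum variable `u`. -/
noncomputable def pdU (f : (Fin 3 → ℝ) → (Fin 3 → ℝ) → ℝ) (u v : Fin 3 → ℝ) (i : Fin 3) : ℝ :=
  fderiv ℝ (fun w => f w v) u (Pi.single i 1)

/-- Partial gradient component in the position variable `v`. -/
noncomputable def pdV (f : (Fin 3 → ℝ) → (Fin 3 → ℝ) → ℝ) (u v : Fin 3 → ℝ) (i : Fin 3) : ℝ :=
  fderiv ℝ (fun w => f u w) v (Pi.single i 1)

/-- Poisson bracket {f,g} = ∇ᵤf·∇ᵥg − ∇ᵥf·∇ᵤg, `u` the momentum conjugate to `v`. -/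
noncomputable def poisson (f g : (Fin 3 → ℝ) → (Fin 3 → ℝ) → ℝ) (u v : Fin 3 → ℝ) : ℝ :=
  (fun i => pdU f u v i) ⬝ᵥ (fun i => pdV g u v i)
    - (fun i => pdV f u v i) ⬝ᵥ (fun i => pdU g u v i)

/-- Euclidean norm on ℝ³. -/
noncomputable def enorm3 (v : Fin 3 → ℝ) : ℝ := Real.sqrt (v ⬝ᵥ v)

/-- The continuous linear functional `w ↦ a ⬝ᵥ w` on ℝ³. -/
noncomputable def dotCLM (a : Fin 3 → ℝ) : (Fin 3 → ℝ) →L[ℝ] ℝ :=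
  ∑ i, a i • ContinuousLinearMap.proj i

lemma dotCLM_apply (a w : Fin 3 → ℝ) : dotCLM a w = a ⬝ᵥ w := by
  simp [dotCLM, dotProduct]

lemma dotCLM_single (a : Fin 3 → ℝ) (i : Fin 3) : dotCLM a (Pi.single i 1) = a i := by
  simp [dotCLM_apply]

lemma hasFDerivAt_dotProduct_left (a x : Fin 3 → ℝ) :
    HasFDerivAt (fun w => a ⬝ᵥ w) (dotCLM a) x :=
  (dotCLM a).hasFDerivAt.congr_of_eventuallyEq
    (Filter.Eventually.of_forall fun w => (dotCLM_apply a w).symm)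

lemma hasFDerivAt_dotProduct_self (a x : Fin 3 → ℝ) :
    HasFDerivAt (fun w => (w + a) ⬝ᵥ (w + a)) (dotCLM ((2 : ℝ) • (x + a))) x := by
  have hp (i : Fin 3) : HasFDerivAt (fun w : Fin 3 → ℝ => (w + a) i)
      (ContinuousLinearMap.proj (R := ℝ) (φ := fun _ : Fin 3 => ℝ) i) x :=
    (hasFDerivAt_apply i x).add_const (a i)
  have h := HasFDerivAt.fun_sum (u := Finset.univ) fun i _ => (hp i).mul (hp i)
  refine h.congr_fderiv ?_
  ext w
  simp [dotCLM, two_mul, add_mul]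

lemma dotProduct_self_pos {x : Fin 3 → ℝ} (hx : x ≠ 0) : 0 < x ⬝ᵥ x :=
  lt_of_le_of_ne (Finset.sum_nonneg fun i _ => mul_self_nonneg (x i))
    fun h => hx (dotProduct_self_eq_zero.mp h.symm)

lemma inv_enorm3_eq {x : Fin 3 → ℝ} (hx : x ≠ 0) :
    (enorm3 x)⁻¹ = (enorm3 x)⁻¹ ^ 3 * (x ⬝ᵥ x) := by
  have hpos := dotProduct_self_pos hx
  have hr : enorm3 x ≠ 0 := (Real.sqrt_pos.mpr hpos).ne'
  have hsq : enorm3 x ^ 2 = x ⬝ᵥ x := Real.sq_sqrt hpos.le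
  rw [← hsq]
  field_simp

/-- The gradient of a Newtonian potential centred at `-a`. -/
lemma hasFDerivAt_div_enorm3 (m : ℝ) {a x : Fin 3 → ℝ} (hx : x + a ≠ 0) :
    HasFDerivAt (fun w => m / enorm3 (w + a))
      (dotCLM ((-(m * (enorm3 (x + a))⁻¹ ^ 3)) • (x + a))) x := by
  have hpos := dotProduct_self_pos hx
  have hr : enorm3 (x + a) ≠ 0 := (Real.sqrt_pos.mpr hpos).ne'
  have hd : HasDerivAt (fun t : ℝ => m * (Real.sqrt t)⁻¹)
      (m * (-(1 / (2 * enorm3 (x + a))) / enorm3 (x + a) ^ 2)) ((x + a) ⬝ᵥ (x + a)) :=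
    ((Real.hasDerivAt_sqrt hpos.ne').fun_inv hr).const_mul m
  have h := hd.comp_hasFDerivAt x (hasFDerivAt_dotProduct_self a x)
  refine (h.congr_fderiv ?_).congr_of_eventuallyEq
    (Filter.Eventually.of_forall fun w => div_eq_mul_inv m (enorm3 (w + a)))
  ext w
  simp only [_root_.smul_apply, dotCLM_apply, smul_dotProduct, smul_eq_mul]
  field_simp

/-- The Euler integral E is a first integral of the two–centre (Euler) Hamiltonian. -/
theorem euler_integral_first_integral_of_two_centre
    (v₀ : Fin 3 → ℝ) (hv₀ : v₀ ≠ 0) (mp mm : ℝ) :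
    ∀ u v : Fin 3 → ℝ, v ≠ v₀ → v ≠ -v₀ →
      poisson
        (fun u v => (u ⬝ᵥ u) / 2 - mp / enorm3 (v + v₀) - mm / enorm3 (v - v₀))
        (fun u v =>
          ((crossProduct v) u ⬝ᵥ (crossProduct v) u) + (v₀ ⬝ᵥ u) ^ 2
            + 2 * (v ⬝ᵥ v₀) * (mp / enorm3 (v + v₀) - mm / enorm3 (v - v₀)))
        u v = 0 := by
  intro u v hv hv'
  have hp : v + v₀ ≠ 0 := fun h => hv' (eq_neg_of_add_eq_zero_left h)
  have hm : v + -v₀ ≠ 0 := fun h => hv (by simpa using eq_neg_of_add_eq_zero_left h)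
  simp only [sub_eq_add_neg _ v₀, cross_dot_cross]
  have hself (x : Fin 3 → ℝ) : HasFDerivAt (fun w : Fin 3 → ℝ => w ⬝ᵥ w)
      (dotCLM ((2 : ℝ) • x)) x := by
    simpa using hasFDerivAt_dotProduct_self 0 x
  have hright (a x : Fin 3 → ℝ) : HasFDerivAt (fun w : Fin 3 → ℝ => w ⬝ᵥ a) (dotCLM a) x := by
    simpa only [dotProduct_comm a] using hasFDerivAt_dotProduct_left a x
  have hVp := hasFDerivAt_div_enorm3 mp hp
  have hVm := hasFDerivAt_div_enorm3 mm hm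
  have hJu := (((hself u).mul_const (2 : ℝ)⁻¹).sub_const (mp / enorm3 (v + v₀))).sub_const
    (mm / enorm3 (v + -v₀))
  have hJv := (hVp.const_sub (u ⬝ᵥ u / 2)).fun_sub hVm
  have hEu := (((((hself u).const_mul (v ⬝ᵥ v)).fun_sub
    ((hasFDerivAt_dotProduct_left v u).fun_mul (hright v u))).fun_add
      ((hasFDerivAt_dotProduct_left v₀ u).pow 2)).add_const
        (2 * (v ⬝ᵥ v₀) * (mp / enorm3 (v + v₀) - mm / enorm3 (v + -v₀))))
  have hEv := (((((hself v).mul_const (u ⬝ᵥ u)).fun_sub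
    ((hright u v).fun_mul (hasFDerivAt_dotProduct_left u v))).add_const ((v₀ ⬝ᵥ u) ^ 2)).fun_add
      (((hright v₀ v).const_mul 2).fun_mul (hVp.fun_sub hVm)))
  have hsp := inv_enorm3_eq hp
  have hsm := inv_enorm3_eq hm
  simp only [← div_eq_mul_inv] at hJu
  simp only [poisson, pdU, pdV, hJu.fderiv, hJv.fderiv, hEu.fderiv, hEv.fderiv]
  simp only [div_eq_mul_inv]
  generalize (enorm3 (v + v₀))⁻¹ = s at *
  generalize (enorm3 (v + -v₀))⁻¹ = t at *
  simp [dotCLM_single, dotProduct, Fin.sum_univ_three] at hsp hsm ⊢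
  linear_combination 2 * (u 0 * v₀ 0 + u 1 * v₀ 1 + u 2 * v₀ 2) * mp * hsp
    - 2 * (u 0 * v₀ 0 + u 1 * v₀ 1 + u 2 * v₀ 2) * mm * hsm
end

section
/- Let Λ > 0, 0 < |Θ| < G < Λ, set a = Λ², e = √(1 − G²/Λ²), let ξ(ℓ) be the unique solution of Kepler's equation ξ − e·sin ξ = ℓ, define ϱ(ℓ) = 1 − e·cos ξ(ℓ), p(ℓ,g) = (cos ξ(ℓ) − e)·cos g − (G/Λ)·sin ξ(ℓ)·sin g, and, for r > 0 with r² + 2ra√(1−Θ²/G²)·p(ℓ,g) + a²ϱ(ℓ)² > 0 for all ℓ and g, define the averaged Newtonian potential U(r, Λ, Θ, G, g) = (1/2π)·∫₀^{2π} dℓ/√(r² + 2ra√(1−Θ²/G²)·p(ℓ,g) + a²ϱ(ℓ)²), and the Euler integral E₀(r, Λ, Θ, G, g) = G² + r·√(1−Θ²/G²)·√(1−G²/Λ²)·cos g. Then U is renormalizably integrable via E₀: there exists a function F of four arguments such that U(r, Λ, Θ, G, g) = F(r, Λ, Θ, E₀(r, Λ, Θ, G, g)) for all (G, g) in the domain;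 in particular, for fixed (r, Λ, Θ), U is constant on the level sets of E₀. -/
open Real

/-- Eccentricity e = √(1 − G²/Λ²). -/
noncomputable def ecc (Λ G : ℝ) : ℝ := Real.sqrt (1 - G ^ 2 / Λ ^ 2)

/-- ϱ = 1 − e·cos ξ. -/
noncomputable def varrho (Λ G ξ : ℝ) : ℝ := 1 - ecc Λ G * Real.cos ξ

/-- p = (cos ξ − e)·cos g − (G/Λ)·sin ξ·sin g. -/
noncomputable def pker (Λ G g ξ : ℝ) : ℝ :=
  (Real.cos ξ - ecc Λ G) * Real.cos g - (G / Λ) * Real.sin ξ * Real.sin g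

/-- The squared distance r² + 2ra√(1−Θ²/G²)·p + a²ϱ², with a = Λ². -/
noncomputable def dsq (Λ Θ G g r ξ : ℝ) : ℝ :=
  r ^ 2 + 2 * r * Λ ^ 2 * Real.sqrt (1 - Θ ^ 2 / G ^ 2) * pker Λ G g ξ
    + (Λ ^ 2) ^ 2 * (varrho Λ G ξ) ^ 2

namespace EulerIntegral

open Set Topology MeasureTheory

/-- The in-plane component of `x'` (in units of `r`) along the perihelion, as a function of the
eccentricity `e` on the level set of value `E`. -/
noncomputable def compA (r a E e : ℝ) : ℝ := (E - a * (1 - e ^ 2)) / (r * e)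

/-- The squared transverse coefficient on the level set of value `E`. -/
noncomputable def transSq (r a E θ e : ℝ) : ℝ :=
  1 - e ^ 2 - θ - (1 - e ^ 2) * compA r a E e ^ 2

/-- The squared distance in terms of the two in-plane coefficients `A` and `b`. -/
noncomputable def distSq (r a A b e x : ℝ) : ℝ :=
  r ^ 2 + 2 * r * a * ((cos x - e) * A - b * sin x) + a ^ 2 * (1 - e * cos x) ^ 2

lemma distSq_pos {r a A b e θ : ℝ} (x : ℝ) (hr : 0 < r) (ha : 0 < a) (he : 0 < e) (he1 : e < 1)
    (hθ : 0 < θ) (hb : b ^ 2 = 1 - e ^ 2 - θ - (1 - e ^ 2) * A ^ 2) :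
    0 < distSq r a A b e x := by
  have hv : 0 < 1 - e ^ 2 := by nlinarith
  have hρ : 0 < 1 - e * cos x := by nlinarith [cos_le_one x, neg_one_le_cos x]
  have hcs := sin_sq_add_cos_sq x
  set P := (cos x - e) * A - b * sin x with hP
  have hid : (1 - e ^ 2) * (P ^ 2 - (1 - e * cos x) ^ 2) =
      - θ * (1 - e * cos x) ^ 2 - ((cos x - e) * b + (1 - e ^ 2) * sin x * A) ^ 2 := by
    have hs : sin x ^ 2 = 1 - cos x ^ 2 := by linarith
    have h1 : (cos x - e) ^ 2 + (1 - e ^ 2) * sin x ^ 2 = (1 - e * cos x) ^ 2 := by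
      rw [hs]; ring
    have h2 : (1 - e ^ 2) * A ^ 2 + b ^ 2 = 1 - e ^ 2 - θ := by rw [hb]; ring
    have h3 : (1 - e ^ 2) * P ^ 2 + ((cos x - e) * b + (1 - e ^ 2) * sin x * A) ^ 2 =
        ((cos x - e) ^ 2 + (1 - e ^ 2) * sin x ^ 2) * ((1 - e ^ 2) * A ^ 2 + b ^ 2) := by
      rw [hP]; ring
    rw [h1, h2] at h3
    linear_combination h3
  have hlt : P ^ 2 < (1 - e * cos x) ^ 2 := by
    have : 0 < θ * (1 - e * cos x) ^ 2 := by positivity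
    nlinarith [sq_nonneg ((cos x - e) * b + (1 - e ^ 2) * sin x * A)]
  have habs := abs_lt_of_sq_lt_sq hlt hρ.le
  rw [abs_lt] at habs
  unfold distSq
  rw [← hP]
  have : 0 < r * a * (P + (1 - e * cos x)) := by
    have : 0 < P + (1 - e * cos x) := by linarith
    positivity
  nlinarith [sq_nonneg (r - a * (1 - e * cos x))]

/-- Positivity propagates to the interior, because the cubic in `1 - e ^ 2` obtained by clearing
denominators is negative at `0`. -/
lemma transSq_pos_of_between {r a E θ e₁ e₂ e : ℝ} (hr : 0 < r) (hθ : 0 < θ)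
    (h₁ : 0 < e₁) (h₂ : e₂ < 1) (hR₁ : 0 ≤ transSq r a E θ e₁) (hR₂ : 0 ≤ transSq r a E θ e₂)
    (he₁ : e₁ < e) (he₂ : e < e₂) : 0 < transSq r a E θ e := by
  set S : ℝ → ℝ := fun v => r ^ 2 * (1 - v) * (v - θ) - v * (E - a * v) ^ 2 with hS
  have key : ∀ t : ℝ, 0 < t → S (1 - t ^ 2) = r ^ 2 * t ^ 2 * transSq r a E θ t := by
    intro t ht
    simp only [hS, transSq, compA]
    field_simp
    ring
  have he : 0 < e := h₁.trans he₁
  have hS₁ : 0 ≤ S (1 - e₁ ^ 2) := by rw [key _ h₁]; positivity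
  have hS₂ : 0 ≤ S (1 - e₂ ^ 2) := by rw [key _ (by linarith)]; positivity
  have hv₂ : 0 < 1 - e₂ ^ 2 := by nlinarith
  have hd₁ : 1 - e ^ 2 < 1 - e₁ ^ 2 := by nlinarith
  have hd₂ : 1 - e₂ ^ 2 < 1 - e ^ 2 := by nlinarith
  have hpos : 0 < S (1 - e ^ 2) := by
    generalize 1 - e ^ 2 = v at *
    generalize 1 - e₁ ^ 2 = v₁ at *
    generalize 1 - e₂ ^ 2 = v₂ at *
    have hv : 0 < v := hv₂.trans hd₂
    have hv₁ : 0 < v₁ := hv.trans hd₁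
    have p₁ : 0 < v₁ - v := by linarith
    have p₂ : 0 < v - v₂ := by linarith
    have p₃ : 0 < v₁ - v₂ := by linarith
    have hid : v₁ * v₂ * (v₁ - v₂) * S v = r ^ 2 * θ * (v - v₂) * (v₁ - v) * (v₁ - v₂)
        + S v₂ * v * (v₁ - v) * v₁ + S v₁ * v * (v - v₂) * v₂
        + a ^ 2 * v * (v - v₂) * (v₁ - v) * v₁ * v₂ * (v₁ - v₂) := by
      simp only [hS]; ring
    have : 0 < v₁ * v₂ * (v₁ - v₂) * S v := by rw [hid]; positivity
    exact pos_of_mul_pos_right this (by positivity)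
  rw [key _ he] at hpos
  exact pos_of_mul_pos_right hpos (by positivity)

/-- The derivative of `compA` in `e`. -/
noncomputable def compA' (r a E e : ℝ) : ℝ := 2 * a / r - compA r a E e / e

/-- The derivative of `transSq` in `e`. -/
noncomputable def transSq' (r a E e : ℝ) : ℝ :=
  -2 * e + 2 * e * compA r a E e ^ 2 - 2 * (1 - e ^ 2) * compA r a E e * compA' r a E e

/-- The squared distance along the level set of value `E`. -/
noncomputable def levelDistSq (r a E θ e x : ℝ) : ℝ :=
  distSq r a (compA r a E e) (√(transSq r a E θ e)) e x

/-- The derivative of `levelDistSq` in `e`. -/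
noncomputable def levelDistSq' (r a E θ e x : ℝ) : ℝ :=
  2 * r * a * (-compA r a E e + (cos x - e) * compA' r a E e
    - transSq' r a E e / (2 * √(transSq r a E θ e)) * sin x)
    - 2 * a ^ 2 * (1 - e * cos x) * cos x

/-- The integrand of the averaged potential in the eccentric anomaly. -/
noncomputable def integrand (r a E θ e x : ℝ) : ℝ :=
  (1 - e * cos x) / √(levelDistSq r a E θ e x)

/-- The derivative of `integrand` in `e`. -/
noncomputable def integrand' (r a E θ e x : ℝ) : ℝ :=
  (-2 * cos x * levelDistSq r a E θ e x - (1 - e * cos x) * levelDistSq' r a E θ e x)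
    / (2 * levelDistSq r a E θ e x * √(levelDistSq r a E θ e x))

/-- The numerator of a primitive of `integrand'` in the eccentric anomaly. -/
noncomputable def primNum (r a E θ e x : ℝ) : ℝ :=
  ((r - 2 * a * e * compA r a E e + a * compA r a E e / e) / a + compA r a E e * cos x)
    / √(transSq r a E θ e) - 2 * sin x

section Derivatives

variable {r a E θ e : ℝ}

lemma hasDerivAt_compA (hr : r ≠ 0) (he : e ≠ 0) :
    HasDerivAt (compA r a E) (compA' r a E e) e := by
  have h : HasDerivAt (fun t : ℝ => (E - a * (1 - t ^ 2)) / (r * t))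
      (((2 * a * e) * (r * e) - (E - a * (1 - e ^ 2)) * r) / (r * e) ^ 2) e := by
    refine HasDerivAt.fun_div ?_ ?_ (by positivity)
    · have := (((hasDerivAt_id' e).fun_pow 2).const_sub 1 |>.const_mul a).const_sub E
      refine this.congr_deriv ?_
      ring
    · simpa using (hasDerivAt_id' e).const_mul r
  refine h.congr_deriv ?_
  unfold compA' compA
  field_simp

lemma hasDerivAt_transSq (hr : r ≠ 0) (he : e ≠ 0) :
    HasDerivAt (transSq r a E θ) (transSq' r a E e) e := by
  have hA := hasDerivAt_compA (a := a) (E := E) hr he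
  have h1 : HasDerivAt (fun t : ℝ => 1 - t ^ 2) (-(2 * e)) e := by
    simpa using ((hasDerivAt_id' e).fun_pow 2).const_sub 1
  have h := (h1.sub_const θ).fun_sub (h1.fun_mul (hA.fun_pow 2))
  refine h.congr_deriv ?_
  unfold transSq'
  simp
  ring

lemma hasDerivAt_levelDistSq (hr : r ≠ 0) (he : e ≠ 0) (hR : 0 < transSq r a E θ e) (x : ℝ) :
    HasDerivAt (fun t => levelDistSq r a E θ t x) (levelDistSq' r a E θ e x) e := by
  have hA := hasDerivAt_compA (a := a) (E := E) hr he
  have hb := (hasDerivAt_transSq (a := a) (E := E) (θ := θ) hr he).sqrt hR.ne'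
  have h1 : HasDerivAt (fun t : ℝ => 1 - t * cos x) (-cos x) e := by
    simpa using ((hasDerivAt_id' e).mul_const (cos x)).const_sub 1
  have h2 : HasDerivAt (fun t : ℝ => cos x - t) (-1) e := (hasDerivAt_id' e).const_sub (cos x)
  have h := (((h2.fun_mul hA).fun_sub (hb.mul_const (sin x))).const_mul (2 * r * a)
    |>.const_add (r ^ 2)).fun_add ((h1.fun_pow 2).const_mul (a ^ 2))
  refine h.congr_deriv ?_
  unfold levelDistSq'
  simp
  ring

lemma hasDerivAt_integrand (hr : r ≠ 0) (he : e ≠ 0) (hR : 0 < transSq r a E θ e) (x : ℝ)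
    (hQ : 0 < levelDistSq r a E θ e x) :
    HasDerivAt (fun t => integrand r a E θ t x) (integrand' r a E θ e x) e := by
  have h1 : HasDerivAt (fun t : ℝ => 1 - t * cos x) (-cos x) e := by
    simpa using ((hasDerivAt_id' e).mul_const (cos x)).const_sub 1
  have hs := sqrt_pos.2 hQ
  have h := h1.fun_div ((hasDerivAt_levelDistSq hr he hR x).sqrt hQ.ne') hs.ne'
  refine h.congr_deriv ?_
  unfold integrand'
  have hsq := sq_sqrt hQ.le
  generalize √(levelDistSq r a E θ e x) = q at *
  rw [← hsq]
  field_simp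

lemma hasDerivAt_prim (hr : r ≠ 0) (ha : a ≠ 0) (he : e ≠ 0) (hR : 0 < transSq r a E θ e)
    (x : ℝ) (hQ : 0 < levelDistSq r a E θ e x) :
    HasDerivAt (fun y => primNum r a E θ e y / √(levelDistSq r a E θ e y))
      (integrand' r a E θ e x) x := by
  have hb := sqrt_pos.2 hR
  have hbsq := sq_sqrt hR.le
  have hs := sqrt_pos.2 hQ
  have hsq := sq_sqrt hQ.le
  have hn : HasDerivAt (fun y => primNum r a E θ e y)
      (-(compA r a E e * sin x) / √(transSq r a E θ e) - 2 * cos x) x := by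
    have := ((((hasDerivAt_cos x).const_mul (compA r a E e)).const_add
      ((r - 2 * a * e * compA r a E e + a * compA r a E e / e) / a)).div_const
      (√(transSq r a E θ e))).fun_sub ((hasDerivAt_sin x).const_mul 2)
    refine this.congr_deriv ?_
    ring
  have hd : HasDerivAt (fun y => levelDistSq r a E θ e y)
      (2 * r * a * (-sin x * compA r a E e - √(transSq r a E θ e) * cos x)
        + 2 * a ^ 2 * (1 - e * cos x) * (e * sin x)) x := by
    have h1 := (((hasDerivAt_cos x).sub_const e).mul_const (compA r a E e)).fun_sub
      ((hasDerivAt_sin x).const_mul √(transSq r a E θ e))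
    have h2 := (((hasDerivAt_cos x).const_mul e).const_sub 1).fun_pow 2
    have := ((h1.const_mul (2 * r * a)).const_add (r ^ 2)).fun_add (h2.const_mul (a ^ 2))
    refine this.congr_deriv ?_
    simp
    ring
  have h := hn.fun_div (hd.sqrt hQ.ne') hs.ne'
  refine h.congr_deriv ?_
  have key : -2 * cos x * levelDistSq r a E θ e x
      - (1 - e * cos x) * levelDistSq' r a E θ e x =
      2 * (-(compA r a E e * sin x) / √(transSq r a E θ e) - 2 * cos x) * levelDistSq r a E θ e x
      - primNum r a E θ e x * (2 * r * a * (-sin x * compA r a E e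
        - √(transSq r a E θ e) * cos x) + 2 * a ^ 2 * (1 - e * cos x) * (e * sin x)) := by
    have hcs : sin x ^ 2 = 1 - cos x ^ 2 := by linarith [sin_sq_add_cos_sq x]
    unfold levelDistSq' levelDistSq primNum distSq transSq' compA'
    generalize compA r a E e = A at *
    generalize √(transSq r a E θ e) = b at *
    generalize sin x = s at *
    generalize cos x = c at *
    linear_combination (norm := (field_simp; ring)) (-4 * a ^ 2 * e * (1 - e * c)) * hcs
  unfold integrand'
  rw [key]
  generalize √(levelDistSq r a E θ e x) = q at *
  rw [← hsq]
  field_simp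

end Derivatives

/-- The potential as an integral over the eccentric anomaly, along the level set of value `E`. -/
noncomputable def levelPotential (r a E θ e : ℝ) : ℝ :=
  ∫ x in (0 : ℝ)..(2 * π), integrand r a E θ e x

section Constancy

variable {r a E θ e e₁ e₂ : ℝ}

lemma levelDistSq_pos (hr : 0 < r) (ha : 0 < a) (he : 0 < e) (he1 : e < 1) (hθ : 0 < θ)
    (hR : 0 ≤ transSq r a E θ e) (x : ℝ) : 0 < levelDistSq r a E θ e x :=
  distSq_pos x hr ha he he1 hθ (sq_sqrt hR)

lemma continuousOn_compA (hr : r ≠ 0) : ContinuousOn (compA r a E) {0}ᶜ := by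
  unfold compA
  refine ContinuousOn.div (by fun_prop) (by fun_prop) ?_
  intro x hx
  exact mul_ne_zero hr hx

lemma continuousOn_transSq (hr : r ≠ 0) : ContinuousOn (transSq r a E θ) {0}ᶜ := by
  have := continuousOn_compA (a := a) (E := E) hr
  unfold transSq
  fun_prop

lemma continuousOn_levelDistSq (hr : r ≠ 0) :
    ContinuousOn (fun p : ℝ × ℝ => levelDistSq r a E θ p.1 p.2) ({0}ᶜ ×ˢ univ) := by
  have hf : MapsTo (Prod.fst : ℝ × ℝ → ℝ) (({0}ᶜ : Set ℝ) ×ˢ (univ : Set ℝ)) {0}ᶜ :=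
    fun p hp => hp.1
  have h1 := (continuousOn_compA (a := a) (E := E) hr).comp continuousOn_fst hf
  have h2 := ((continuousOn_transSq (a := a) (E := E) (θ := θ) hr).comp continuousOn_fst hf).sqrt
  simp only [Function.comp_def] at h1 h2
  unfold levelDistSq distSq
  fun_prop

lemma continuousOn_integrand (hr : 0 < r) (ha : 0 < a) (hθ : 0 < θ) :
    ContinuousOn (fun p : ℝ × ℝ => integrand r a E θ p.1 p.2)
      ({e | 0 < e ∧ e < 1 ∧ 0 ≤ transSq r a E θ e} ×ˢ univ) := by
  have h := (continuousOn_levelDistSq (a := a) (E := E) (θ := θ) hr.ne').mono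
    (prod_mono (s₁ := {e | 0 < e ∧ e < 1 ∧ 0 ≤ transSq r a E θ e})
      (fun t ht => ht.1.ne') subset_rfl)
  unfold integrand
  refine ContinuousOn.div (by fun_prop) h.sqrt ?_
  rintro ⟨t, x⟩ ⟨⟨h0, h1, hR⟩, -⟩
  exact (sqrt_pos.2 (levelDistSq_pos hr ha h0 h1 hθ hR x)).ne'

lemma continuousOn_integrand' (hr : 0 < r) (ha : 0 < a) (hθ : 0 < θ) :
    ContinuousOn (fun p : ℝ × ℝ => integrand' r a E θ p.1 p.2)
      ({e | 0 < e ∧ e < 1 ∧ 0 < transSq r a E θ e} ×ˢ univ) := by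
  set s : Set ℝ := {e | 0 < e ∧ e < 1 ∧ 0 < transSq r a E θ e}
  have hs : s ⊆ {0}ᶜ := fun t ht => ht.1.ne'
  have hf : MapsTo (Prod.fst : ℝ × ℝ → ℝ) (s ×ˢ (univ : Set ℝ)) s := fun p hp => hp.1
  have hQ := (continuousOn_levelDistSq (a := a) (E := E) (θ := θ) hr.ne').mono
    (prod_mono hs subset_rfl)
  have hA := ((continuousOn_compA (a := a) (E := E) hr.ne').mono hs).comp continuousOn_fst hf
  have hb := (((continuousOn_transSq (a := a) (E := E) (θ := θ) hr.ne').mono hs).comp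
    continuousOn_fst hf).sqrt
  simp only [Function.comp_def] at hA hb
  have hA' : ContinuousOn (fun p : ℝ × ℝ => compA' r a E p.1) (s ×ˢ univ) := by
    unfold compA'
    exact continuousOn_const.sub (hA.div continuousOn_fst fun p hp => hp.1.1.ne')
  have hb' : ContinuousOn
      (fun p : ℝ × ℝ => transSq' r a E p.1 / (2 * √(transSq r a E θ p.1))) (s ×ˢ univ) := by
    refine ContinuousOn.div ?_ (by fun_prop) fun p hp =>
      (mul_pos two_pos (sqrt_pos.2 hp.1.2.2)).ne'
    unfold transSq'
    fun_prop
  have hQ' : ContinuousOn (fun p : ℝ × ℝ => levelDistSq' r a E θ p.1 p.2) (s ×ˢ univ) := by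
    unfold levelDistSq'
    fun_prop
  unfold integrand'
  refine ContinuousOn.div (by fun_prop) (by fun_prop) ?_
  rintro ⟨t, x⟩ ⟨⟨h0, h1, hR⟩, -⟩
  have := levelDistSq_pos hr ha h0 h1 hθ hR.le x
  have := sqrt_pos.2 this
  positivity

lemma continuous_slice {f : ℝ × ℝ → ℝ} {s : Set ℝ} (hf : ContinuousOn f (s ×ˢ univ)) {t : ℝ}
    (ht : t ∈ s) : Continuous fun x => f (t, x) :=
  hf.comp_continuous (by fun_prop) fun _ => ⟨ht, mem_univ _⟩

lemma integral_integrand'_eq_zero (hr : 0 < r) (ha : 0 < a) (he : 0 < e) (he1 : e < 1)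
    (hθ : 0 < θ) (hR : 0 < transSq r a E θ e) :
    ∫ x in (0 : ℝ)..(2 * π), integrand' r a E θ e x = 0 := by
  have hc : Continuous (integrand' r a E θ e) :=
    continuous_slice (continuousOn_integrand' (E := E) hr ha hθ) ⟨he, he1, hR⟩
  rw [intervalIntegral.integral_eq_sub_of_hasDerivAt (fun x _ => hasDerivAt_prim hr.ne' ha.ne'
    he.ne' hR x (levelDistSq_pos hr ha he he1 hθ hR.le x)) (hc.intervalIntegrable _ _)]
  simp [primNum, levelDistSq, distSq]

lemma hasDerivAt_levelPotential (hr : 0 < r) (ha : 0 < a) (he : 0 < e) (he1 : e < 1)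
    (hθ : 0 < θ) (hR : 0 < transSq r a E θ e) :
    HasDerivAt (levelPotential r a E θ) 0 e := by
  have hpos : ∀ᶠ t in 𝓝 e, 0 < t ∧ t < 1 ∧ 0 < transSq r a E θ t :=
    (eventually_gt_nhds he).and ((eventually_lt_nhds he1).and
      ((hasDerivAt_transSq hr.ne' he.ne').continuousAt.eventually_const_lt hR))
  obtain ⟨ε, hε, hball⟩ := Metric.nhds_basis_closedBall.mem_iff.1 hpos
  have hc' := continuousOn_integrand' (E := E) hr ha hθ
  have hc := continuousOn_integrand (E := E) hr ha hθ
  obtain ⟨C, hC⟩ := ((isCompact_closedBall e ε).prod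
    (isCompact_uIcc (a := (0 : ℝ)) (b := 2 * π))).exists_bound_of_continuousOn
      (hc'.mono (prod_mono hball (subset_univ _)))
  have h := (intervalIntegral.hasDerivAt_integral_of_dominated_loc_of_deriv_le
    (μ := volume) (a := 0) (b := 2 * π) (F := integrand r a E θ) (F' := integrand' r a E θ)
    (bound := fun _ => C) (Metric.closedBall_mem_nhds e hε) ?_ ?_ ?_ ?_ ?_ ?_).2
  · rwa [integral_integrand'_eq_zero hr ha he he1 hθ hR] at h
  · filter_upwards [hpos] with t ht
    exact (continuous_slice hc ⟨ht.1, ht.2.1, ht.2.2.le⟩).aestronglyMeasurable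
  · exact (continuous_slice hc ⟨he, he1, hR.le⟩).intervalIntegrable _ _
  · exact (continuous_slice hc' ⟨he, he1, hR⟩).aestronglyMeasurable
  · exact .of_forall fun x hx t ht => hC (t, x) ⟨ht, uIoc_subset_uIcc hx⟩
  · exact intervalIntegrable_const
  · refine .of_forall fun x _ t ht => ?_
    obtain ⟨h0, h1, h2⟩ := hball ht
    exact hasDerivAt_integrand hr.ne' h0.ne' h2 x (levelDistSq_pos hr ha h0 h1 hθ h2.le x)

lemma levelPotential_eq_of_lt (hr : 0 < r) (ha : 0 < a) (hθ : 0 < θ) (h₁ : 0 < e₁) (h₂ : e₂ < 1)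
    (hR₁ : 0 ≤ transSq r a E θ e₁) (hR₂ : 0 ≤ transSq r a E θ e₂) (h : e₁ < e₂) :
    levelPotential r a E θ e₁ = levelPotential r a E θ e₂ := by
  have hR : ∀ t ∈ Icc e₁ e₂, 0 ≤ transSq r a E θ t := by
    intro t ht
    rcases ht.1.eq_or_lt with rfl | h1
    · exact hR₁
    rcases ht.2.eq_or_lt with rfl | h2
    · exact hR₂
    exact (transSq_pos_of_between hr hθ h₁ h₂ hR₁ hR₂ h1 h2).le
  have hcont : ContinuousOn (levelPotential r a E θ) (Icc e₁ e₂) := by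
    rw [continuousOn_iff_continuous_domRestrict]
    refine intervalIntegral.continuous_parametric_intervalIntegral_of_continuous'
      (f := fun (t : Icc e₁ e₂) x => integrand r a E θ t x) ?_ 0 (2 * π)
    refine (continuousOn_integrand (E := E) hr ha hθ).comp_continuous
      (f := fun p : Icc e₁ e₂ × ℝ => ((p.1 : ℝ), p.2)) (by fun_prop) ?_
    rintro ⟨⟨t, ht⟩, x⟩
    exact ⟨⟨h₁.trans_le ht.1, ht.2.trans_lt h₂, hR t ht⟩, mem_univ _⟩
  obtain ⟨c, -, hc⟩ := exists_hasDerivAt_eq_slope (levelPotential r a E θ) (fun _ => 0) h hcont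
    fun t ht => hasDerivAt_levelPotential hr ha (h₁.trans ht.1) (ht.2.trans h₂) hθ
      (transSq_pos_of_between hr hθ h₁ h₂ hR₁ hR₂ ht.1 ht.2)
  have := sub_ne_zero.2 h.ne'
  field_simp at hc
  linarith

lemma levelPotential_eq (hr : 0 < r) (ha : 0 < a) (hθ : 0 < θ) (h₁ : 0 < e₁) (h₁' : e₁ < 1)
    (h₂ : 0 < e₂) (h₂' : e₂ < 1) (hR₁ : 0 ≤ transSq r a E θ e₁) (hR₂ : 0 ≤ transSq r a E θ e₂) :
    levelPotential r a E θ e₁ = levelPotential r a E θ e₂ := by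
  rcases lt_trichotomy e₁ e₂ with h | rfl | h
  · exact levelPotential_eq_of_lt hr ha hθ h₁ h₂' hR₁ hR₂ h
  · rfl
  · exact (levelPotential_eq_of_lt hr ha hθ h₂ h₁' hR₂ hR₁ h).symm

end Constancy

/-- Reflecting the ellipse in its major axis does not change the average. -/
lemma integral_distSq_neg (r a A b e : ℝ) :
    ∫ x in (0 : ℝ)..(2 * π), (1 - e * cos x) / √(distSq r a A (-b) e x) =
      ∫ x in (0 : ℝ)..(2 * π), (1 - e * cos x) / √(distSq r a A b e x) := by
  have h := intervalIntegral.integral_comp_sub_left (a := 0) (b := 2 * π)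
    (fun x => (1 - e * cos x) / √(distSq r a A b e x)) (2 * π)
  rw [sub_self, sub_zero] at h
  rw [← h]
  simp [distSq, cos_two_pi_sub, sin_two_pi_sub]

/-- Averages over the mean anomaly as integrals over the eccentric anomaly. -/
lemma integral_kepler {e : ℝ} (he : 0 ≤ e) (he1 : e < 1) {ξ : ℝ → ℝ}
    (hξ : ∀ l, ξ l - e * sin (ξ l) = l) {f : ℝ → ℝ} (hf : Continuous f) :
    ∫ l in (0 : ℝ)..(2 * π), f (ξ l) = ∫ x in (0 : ℝ)..(2 * π), (1 - e * cos x) * f x := by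
  have hinj : ∀ x y : ℝ, (1 - e) * |x - y| ≤ |(x - e * sin x) - (y - e * sin y)| := by
    intro x y
    have h1 := abs_sin_sub_sin_le x y
    have h2 : x - y = ((x - e * sin x) - (y - e * sin y)) + e * (sin x - sin y) := by ring
    have h3 := abs_add_le ((x - e * sin x) - (y - e * sin y)) (e * (sin x - sin y))
    rw [← h2, abs_mul, abs_of_nonneg he] at h3
    nlinarith [mul_le_mul_of_nonneg_left h1 he]
  have hcont : Continuous ξ := by
    refine LipschitzWith.continuous (K := (Real.toNNReal (1 - e)⁻¹))
      (LipschitzWith.of_dist_le_mul fun x y => ?_)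
    have hpos : 0 < 1 - e := by linarith
    have := hinj (ξ x) (ξ y)
    rw [hξ, hξ] at this
    rw [Real.coe_toNNReal _ (by positivity), Real.dist_eq, Real.dist_eq]
    field_simp
    linarith
  have hinv : ∀ x, ξ (x - e * sin x) = x := by
    intro x
    have := hinj (ξ (x - e * sin x)) x
    rw [hξ, sub_self, abs_zero] at this
    have h0 : |ξ (x - e * sin x) - x| ≤ 0 := by
      by_contra! hlt
      nlinarith
    linarith [abs_nonpos_iff.1 h0]
  have h := intervalIntegral.integral_comp_mul_deriv (a := 0) (b := 2 * π)
    (f := fun x => x - e * sin x) (f' := fun x => 1 - e * cos x) (g := fun l => f (ξ l))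
    (fun x _ => (hasDerivAt_id' x).fun_sub ((hasDerivAt_sin x).const_mul e)) (by fun_prop)
    (by fun_prop)
  simp only [Function.comp_def, hinv, sin_zero, sin_two_pi, mul_zero, sub_zero] at h
  rw [← h]
  simp only [mul_comm]

lemma transSq_eq_sq {r a E θ A b e : ℝ} (hA : A = compA r a E e)
    (hb : b ^ 2 = 1 - e ^ 2 - θ - (1 - e ^ 2) * A ^ 2) : transSq r a E θ e = b ^ 2 := by
  rw [hb, hA, transSq]

lemma integral_eq_levelPotential {r a E θ A b e : ℝ} (hA : A = compA r a E e)
    (hb : b ^ 2 = 1 - e ^ 2 - θ - (1 - e ^ 2) * A ^ 2) :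
    ∫ x in (0 : ℝ)..(2 * π), (1 - e * cos x) / √(distSq r a A b e x) =
      levelPotential r a E θ e := by
  unfold levelPotential integrand levelDistSq
  rw [transSq_eq_sq hA hb, sqrt_sq_eq_abs, ← hA]
  rcases abs_choice b with h | h <;> rw [h]
  rw [integral_distSq_neg]

/-- The averaged potential at `(G, g)` equals the potential on the level set of the Euler
integral. -/
lemma average_eq_levelPotential {Λ Θ r G : ℝ} (g : ℝ) (hΛ : 0 < Λ) (hΘ : 0 < |Θ|) (hr : 0 < r)
    {ξ : ℝ → ℝ} (hG : |Θ| < G) (hGΛ : G < Λ) (hξ : ∀ l, ξ l - ecc Λ G * sin (ξ l) = l) :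
    (0 < ecc Λ G ∧ ecc Λ G < 1) ∧
    0 ≤ transSq r (Λ ^ 2) (G ^ 2 + r * √(1 - Θ ^ 2 / G ^ 2) * √(1 - G ^ 2 / Λ ^ 2) * cos g)
      (Θ ^ 2 / Λ ^ 2) (ecc Λ G) ∧
    ∫ l in (0 : ℝ)..(2 * π), 1 / √(dsq Λ Θ G g r (ξ l)) = levelPotential r (Λ ^ 2)
      (G ^ 2 + r * √(1 - Θ ^ 2 / G ^ 2) * √(1 - G ^ 2 / Λ ^ 2) * cos g)
      (Θ ^ 2 / Λ ^ 2) (ecc Λ G) := by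
  have hG0 : 0 < G := hΘ.trans hG
  have hΘ2 : 0 < Θ ^ 2 := by rw [← sq_abs]; positivity
  have hΘG : Θ ^ 2 < G ^ 2 := by rw [← sq_abs]; nlinarith
  have hs : √(1 - Θ ^ 2 / G ^ 2) ^ 2 = 1 - Θ ^ 2 / G ^ 2 :=
    sq_sqrt (by rw [sub_nonneg, div_le_one (by positivity)]; exact hΘG.le)
  have hq : 0 < 1 - G ^ 2 / Λ ^ 2 := by
    rw [sub_pos, div_lt_one (by positivity)]; nlinarith
  have hesq : ecc Λ G ^ 2 = 1 - G ^ 2 / Λ ^ 2 := sq_sqrt hq.le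
  have he : 0 < ecc Λ G := sqrt_pos.2 hq
  have he1 : ecc Λ G < 1 := by
    have : 0 < G ^ 2 / Λ ^ 2 := by positivity
    nlinarith
  change _ ∧ 0 ≤ transSq r (Λ ^ 2) (G ^ 2 + r * √(1 - Θ ^ 2 / G ^ 2) * ecc Λ G * cos g) _ _ ∧
    _ = levelPotential r (Λ ^ 2) (G ^ 2 + r * √(1 - Θ ^ 2 / G ^ 2) * ecc Λ G * cos g) _ _
  have hQ : ∀ x, dsq Λ Θ G g r x = distSq r (Λ ^ 2) (√(1 - Θ ^ 2 / G ^ 2) * cos g)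
      (√(1 - Θ ^ 2 / G ^ 2) * (G / Λ) * sin g) (ecc Λ G) x := by
    intro x
    unfold dsq pker varrho distSq
    ring
  generalize √(1 - Θ ^ 2 / G ^ 2) = s at *
  generalize ecc Λ G = e at *
  have hA : s * cos g = compA r (Λ ^ 2) (G ^ 2 + r * s * e * cos g) e := by
    unfold compA
    rw [hesq]
    field_simp
    ring
  have hb : (s * (G / Λ) * sin g) ^ 2 =
      1 - e ^ 2 - Θ ^ 2 / Λ ^ 2 - (1 - e ^ 2) * (s * cos g) ^ 2 := by
    rw [mul_pow, mul_pow, mul_pow, hs, hesq, sin_sq]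
    field_simp
    ring
  refine ⟨⟨he, he1⟩, ?_, ?_⟩
  · rw [transSq_eq_sq hA hb]
    positivity
  · rw [← integral_eq_levelPotential hA hb]
    simp only [hQ]
    have hpos : ∀ x, 0 < distSq r (Λ ^ 2) (s * cos g) (s * (G / Λ) * sin g) e x := fun x =>
      distSq_pos x hr (by positivity) he he1 (by positivity) hb
    rw [integral_kepler he.le he1 hξ
      (f := fun x => 1 / √(distSq r (Λ ^ 2) (s * cos g) (s * (G / Λ) * sin g) e x))]
    · simp only [mul_one_div]
    · refine continuous_const.div ?_ fun x => (sqrt_pos.2 (hpos x)).ne'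
      unfold distSq
      fun_prop

end EulerIntegral

/-- The averaged Newtonian potential U is renormalizably integrable via the Euler
integral E₀: there is F, a function of four arguments, with
U(r,Λ,Θ,G,g) = F(r,Λ,Θ,E₀(r,Λ,Θ,G,g)) on the domain 0 < |Θ| < G < Λ. -/
theorem U_renormalizably_integrable_via_E0
    (Λ Θ r : ℝ) (hΛ : 0 < Λ) (hΘ : 0 < |Θ|) (hr : 0 < r)
    (ξ : ℝ → ℝ → ℝ)
    (hξ : ∀ G, |Θ| < G → G < Λ → ∀ ℓ, ξ G ℓ - ecc Λ G * Real.sin (ξ G ℓ) = ℓ)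
    (hpos : ∀ G g ℓ, |Θ| < G → G < Λ → 0 < dsq Λ Θ G g r (ξ G ℓ))
    (U E₀ : ℝ → ℝ → ℝ)
    (hU : ∀ G g, U G g =
      (1 / (2 * π)) * ∫ ℓ in (0:ℝ)..(2 * π), 1 / Real.sqrt (dsq Λ Θ G g r (ξ G ℓ)))
    (hE₀ : ∀ G g, E₀ G g = G ^ 2
      + r * Real.sqrt (1 - Θ ^ 2 / G ^ 2) * Real.sqrt (1 - G ^ 2 / Λ ^ 2) * Real.cos g) :
    ∃ F : ℝ → ℝ → ℝ → ℝ → ℝ,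
      ∀ G g, |Θ| < G → G < Λ → U G g = F r Λ Θ (E₀ G g) := by
  refine ⟨fun _ _ _ => Function.extend (fun p : {p : ℝ × ℝ // |Θ| < p.1 ∧ p.1 < Λ} =>
    E₀ p.1.1 p.1.2) (fun p => U p.1.1 p.1.2) 0, fun G g hG hGΛ => ?_⟩
  have hfac : Function.FactorsThrough (fun p : {p : ℝ × ℝ // |Θ| < p.1 ∧ p.1 < Λ} =>
      U p.1.1 p.1.2) (fun p => E₀ p.1.1 p.1.2) := by
    rintro ⟨⟨G₁, g₁⟩, h₁, h₁'⟩ ⟨⟨G₂, g₂⟩, h₂, h₂'⟩ hE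
    simp only [hE₀] at hE
    obtain ⟨⟨p₁, q₁⟩, R₁, I₁⟩ :=
      EulerIntegral.average_eq_levelPotential g₁ hΛ hΘ hr h₁ h₁' (hξ G₁ h₁ h₁')
    obtain ⟨⟨p₂, q₂⟩, R₂, I₂⟩ :=
      EulerIntegral.average_eq_levelPotential g₂ hΛ hΘ hr h₂ h₂' (hξ G₂ h₂ h₂')
    have hΘ2 : 0 < Θ ^ 2 := by rw [← sq_abs]; positivity
    simp only [hU, I₁, I₂]
    rw [hE] at R₁ ⊢
    rw [EulerIntegral.levelPotential_eq hr (by positivity) (by positivity) p₁ q₁ p₂ q₂ R₁ R₂]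
  exact (hfac.extend_apply 0 ⟨(G, g), hG, hGΛ⟩).symm
end

section
/- With the definitions of the previous context (Λ > 0, 0 < |Θ| < G < Λ, a = Λ², e = √(1−G²/Λ²), ξ(ℓ) the unique solution of ξ − e·sin ξ = ℓ, ϱ = 1 − e·cos ξ, p = (cos ξ − e)cos g − (G/Λ) sin ξ sin g, and r such that r² + 2ra√(1−Θ²/G²)·p + a²ϱ² > 0 for all ℓ, g), let U(r,Λ,Θ,G,g) = (1/2π)·∫₀^{2π} dℓ/√(r² + 2ra√(1−Θ²/G²)·p + a²ϱ²) and E₀(r,Λ,Θ,G,g) = G² + r√(1−Θ²/G²)·√(1−G²/Λ²)·cos g. Then, for fixed (r,Λ,Θ), the functions U and E₀ Poisson-commute in the conjugate pair (G,g): ∂U/∂G · ∂E₀/∂g − ∂U/∂g · ∂E₀/∂G = 0 at every point (G,g) of the domain. -/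
open Real

open Set Filter Topology MeasureTheory

/-- Differentiation under the integral sign, for an integrand whose derivative in the parameter is
jointly continuous. -/
theorem hasDerivAt_intervalIntegral_of_continuousOn {F F' : ℝ → ℝ → ℝ} {I : Set ℝ} {a b y₀ : ℝ}
    (hI : IsOpen I) (hy₀ : y₀ ∈ I) (hF : ∀ y ∈ I, Continuous (F y))
    (hF' : ContinuousOn (fun q : ℝ × ℝ => F' q.1 q.2) (I ×ˢ univ))
    (hd : ∀ y ∈ I, ∀ x, HasDerivAt (fun y => F y x) (F' y x) y) :
    Continuous (F' y₀) ∧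
      HasDerivAt (fun y => ∫ x in a..b, F y x) (∫ x in a..b, F' y₀ x) y₀ := by
  have hcont : Continuous (F' y₀) := by
    rw [← continuousOn_univ]
    exact hF'.comp (f := fun x : ℝ => (y₀, x)) (by fun_prop) (fun x _ => ⟨hy₀, mem_univ _⟩)
  refine ⟨hcont, ?_⟩
  obtain ⟨ε, hε, hball⟩ := Metric.nhds_basis_closedBall.mem_iff.1 (hI.mem_nhds hy₀)
  have hK : IsCompact (Metric.closedBall y₀ ε ×ˢ uIcc a b) :=
    (isCompact_closedBall y₀ ε).prod isCompact_uIcc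
  obtain ⟨C, hC⟩ := hK.exists_bound_of_continuousOn
    (hF'.mono (prod_mono hball (subset_univ _)))
  refine (intervalIntegral.hasDerivAt_integral_of_dominated_loc_of_deriv_le (bound := fun _ => C)
    (Metric.closedBall_mem_nhds y₀ hε) ?_ ((hF y₀ hy₀).intervalIntegrable a b)
    hcont.aestronglyMeasurable ?_ intervalIntegrable_const ?_).2
  · filter_upwards [hI.mem_nhds hy₀] with y hy using (hF y hy).aestronglyMeasurable
  · exact Eventually.of_forall fun t ht y hy => hC (y, t) ⟨hy, uIoc_subset_uIcc ht⟩
  · exact Eventually.of_forall fun t _ y hy => hd y (hball hy) t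

theorem HasDerivAt.div_sqrt {u v : ℝ → ℝ} {u' v' y : ℝ} (hu : HasDerivAt u u' y)
    (hv : HasDerivAt v v' y) (hpos : 0 < v y) :
    HasDerivAt (fun z => u z / √(v z)) (u' / √(v y) - u y * v' / (2 * √(v y) * v y)) y := by
  have hs : 0 < √(v y) := Real.sqrt_pos.2 hpos
  refine (hu.div (hv.sqrt hpos.ne') hs.ne').congr_deriv ?_
  have h2 : √(v y) ^ 2 = v y := Real.sq_sqrt hpos.le
  generalize √(v y) = w at *
  rw [← h2]
  field_simp

theorem kepler_deriv_pos {e : ℝ} (h0 : 0 ≤ e) (h1 : e < 1) (x : ℝ) : 0 < 1 - e * cos x := by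
  nlinarith [cos_le_one x, neg_one_le_cos x]

theorem hasDerivAt_kepler (e x : ℝ) :
    HasDerivAt (fun x => x - e * sin x) (1 - e * cos x) x :=
  (hasDerivAt_id x).sub ((hasDerivAt_sin x).const_mul e)

theorem kepler_injective {e : ℝ} (h0 : 0 ≤ e) (h1 : e < 1) :
    Function.Injective fun x : ℝ => x - e * sin x := by
  refine (strictMono_of_deriv_pos fun x => ?_).injective
  rw [(hasDerivAt_kepler e x).deriv]
  exact kepler_deriv_pos h0 h1 x

/-- The substitution of the eccentric anomaly for the mean anomaly over one period. -/
theorem integral_comp_kepler_inverse {e : ℝ} (h0 : 0 ≤ e) (h1 : e < 1) {ξ : ℝ → ℝ}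
    (hξ : ∀ x, ξ (x - e * sin x) = x) (f : ℝ → ℝ) :
    ∫ ℓ in (0 : ℝ)..(2 * π), f (ξ ℓ) = ∫ x in (0 : ℝ)..(2 * π), f x * (1 - e * cos x) := by
  have h := intervalIntegral.integral_comp_mul_deriv_of_deriv_nonneg (a := 0) (b := 2 * π)
    (f := fun x => x - e * sin x) (f' := fun x => 1 - e * cos x) (g := fun ℓ => f (ξ ℓ))
    (by fun_prop) (fun x _ => hasDerivAt_kepler e x) (fun x _ => (kepler_deriv_pos h0 h1 x).le)
  simp only [Function.comp_def, hξ] at h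
  simpa using h.symm

theorem sqrt_one_sub_div_sq_pos {a b : ℝ} (h : |a| < b) : 0 < √(1 - a ^ 2 / b ^ 2) := by
  have hb : 0 < b := (abs_nonneg a).trans_lt h
  have : a ^ 2 < b ^ 2 := sq_lt_sq.2 (by rwa [abs_of_pos hb])
  rw [Real.sqrt_pos, sub_pos, div_lt_one (by positivity)]
  exact this

theorem ecc_pos {Λ G : ℝ} (h0 : 0 < G) (h : G < Λ) : 0 < ecc Λ G :=
  sqrt_one_sub_div_sq_pos (by rwa [abs_of_pos h0])

theorem ecc_sq {Λ G : ℝ} (h0 : 0 < G) (h : G < Λ) : ecc Λ G ^ 2 = 1 - G ^ 2 / Λ ^ 2 :=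
  Real.sq_sqrt (Real.sqrt_pos.1 (ecc_pos h0 h)).le

theorem ecc_lt_one {Λ G : ℝ} (h0 : 0 < G) (h : G < Λ) : ecc Λ G < 1 := by
  have h1 := ecc_sq h0 h
  have h2 : 0 < G ^ 2 / Λ ^ 2 := by have := h0.trans h; positivity
  nlinarith [ecc_pos h0 h]

theorem hasDerivAt_ecc {Λ G : ℝ} (h0 : 0 < G) (h : G < Λ) :
    HasDerivAt (fun G => ecc Λ G) (-(G / (Λ ^ 2 * ecc Λ G))) G := by
  have he := ecc_pos h0 h
  have hΛ := h0.trans h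
  have h1 : HasDerivAt (fun G : ℝ => 1 - G ^ 2 / Λ ^ 2) (-(2 * G / Λ ^ 2)) G := by
    simpa using ((hasDerivAt_pow 2 G).div_const (Λ ^ 2)).const_sub 1
  refine (h1.sqrt (Real.sqrt_pos.1 he).ne').congr_deriv ?_
  change -(2 * G / Λ ^ 2) / (2 * ecc Λ G) = _
  field_simp

theorem hasDerivAt_sqrt_one_sub_div_sq {Θ G : ℝ} (h : |Θ| < G) :
    HasDerivAt (fun G => √(1 - Θ ^ 2 / G ^ 2)) (Θ ^ 2 / (G ^ 3 * √(1 - Θ ^ 2 / G ^ 2))) G := by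
  have hs := sqrt_one_sub_div_sq_pos h
  have hG : G ≠ 0 := ((abs_nonneg Θ).trans_lt h).ne'
  have h1 : HasDerivAt (fun G : ℝ => 1 - Θ ^ 2 / G ^ 2) (2 * Θ ^ 2 / G ^ 3) G := by
    have := ((hasDerivAt_const G (Θ ^ 2)).div (hasDerivAt_pow 2 G) (pow_ne_zero 2 hG)).const_sub 1
    refine this.congr_deriv ?_
    push_cast
    field_simp
    ring
  refine (h1.sqrt (Real.sqrt_pos.1 hs).ne').congr_deriv ?_
  field_simp

/-- The derivative of `varrho` in `G`. -/
noncomputable def varrhoDG (Λ G ξ : ℝ) : ℝ := G / (Λ ^ 2 * ecc Λ G) * cos ξ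

/-- The derivative of `dsq` in `G`. -/
noncomputable def dsqDG (Λ Θ G g r ξ : ℝ) : ℝ :=
  2 * r * Λ ^ 2 * (Θ ^ 2 / (G ^ 3 * √(1 - Θ ^ 2 / G ^ 2)) * pker Λ G g ξ
      + √(1 - Θ ^ 2 / G ^ 2) * (G / (Λ ^ 2 * ecc Λ G) * cos g - 1 / Λ * sin ξ * sin g))
    + (Λ ^ 2) ^ 2 * (2 * varrho Λ G ξ * varrhoDG Λ G ξ)

/-- The derivative of `dsq` in `g`. -/
noncomputable def dsqDg (Λ Θ G g r ξ : ℝ) : ℝ :=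
  2 * r * Λ ^ 2 * √(1 - Θ ^ 2 / G ^ 2)
    * (-((cos ξ - ecc Λ G) * sin g) - G / Λ * sin ξ * cos g)

/-- The derivative of `dsq` in the eccentric anomaly. -/
noncomputable def dsqDξ (Λ Θ G g r ξ : ℝ) : ℝ :=
  2 * r * Λ ^ 2 * √(1 - Θ ^ 2 / G ^ 2) * (-(sin ξ * cos g) - G / Λ * cos ξ * sin g)
    + (Λ ^ 2) ^ 2 * (2 * varrho Λ G ξ * (ecc Λ G * sin ξ))

theorem hasDerivAt_varrho_G {Λ G : ℝ} (h0 : 0 < G) (h : G < Λ) (x : ℝ) :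
    HasDerivAt (fun G => varrho Λ G x) (varrhoDG Λ G x) G := by
  refine (((hasDerivAt_ecc h0 h).mul_const (cos x)).const_sub 1).congr_deriv ?_
  unfold varrhoDG; ring

theorem hasDerivAt_dsq_G {Λ Θ G : ℝ} (h0 : |Θ| < G) (h : G < Λ) (g r x : ℝ) :
    HasDerivAt (fun G => dsq Λ Θ G g r x) (dsqDG Λ Θ G g r x) G := by
  have hG := (abs_nonneg Θ).trans_lt h0
  have hp : HasDerivAt (fun G => pker Λ G g x)
      (G / (Λ ^ 2 * ecc Λ G) * cos g - 1 / Λ * sin x * sin g) G := by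
    refine ((((hasDerivAt_ecc hG h).const_sub (cos x)).mul_const (cos g)).sub
      ((((hasDerivAt_id G).div_const Λ).mul_const (sin x)).mul_const (sin g))).congr_deriv ?_
    ring
  refine (((((hasDerivAt_sqrt_one_sub_div_sq h0).const_mul (2 * r * Λ ^ 2)).mul hp).const_add
    (r ^ 2)).add (((hasDerivAt_varrho_G hG h x).pow 2).const_mul ((Λ ^ 2) ^ 2))).congr_deriv ?_
  unfold dsqDG
  push_cast
  ring

theorem hasDerivAt_dsq_g (Λ Θ G g r x : ℝ) :
    HasDerivAt (fun g => dsq Λ Θ G g r x) (dsqDg Λ Θ G g r x) g := by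
  refine ((((((hasDerivAt_cos g).const_mul (cos x - ecc Λ G)).sub
    ((hasDerivAt_sin g).const_mul (G / Λ * sin x))).const_mul
      (2 * r * Λ ^ 2 * √(1 - Θ ^ 2 / G ^ 2))).const_add (r ^ 2)).add_const
        ((Λ ^ 2) ^ 2 * varrho Λ G x ^ 2)).congr_deriv ?_
  unfold dsqDg
  ring

theorem hasDerivAt_dsq_ξ (Λ Θ G g r x : ℝ) :
    HasDerivAt (fun x => dsq Λ Θ G g r x) (dsqDξ Λ Θ G g r x) x := by
  have hρ : HasDerivAt (fun x => varrho Λ G x) (ecc Λ G * sin x) x := by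
    refine (((hasDerivAt_cos x).const_mul (ecc Λ G)).const_sub 1).congr_deriv ?_
    ring
  refine (((((((hasDerivAt_cos x).sub_const (ecc Λ G)).mul_const (cos g)).sub
    (((hasDerivAt_sin x).const_mul (G / Λ)).mul_const (sin g))).const_mul
      (2 * r * Λ ^ 2 * √(1 - Θ ^ 2 / G ^ 2))).const_add (r ^ 2)).add
        ((hρ.pow 2).const_mul ((Λ ^ 2) ^ 2))).congr_deriv ?_
  unfold dsqDξ
  push_cast
  ring

/-- The numerator of the primitive, in the eccentric anomaly, of the Poisson bracket of the
integrand of `U` with `E₀`. -/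
noncomputable def bracketNumerator (Λ Θ G g r ξ : ℝ) : ℝ :=
  r ^ 2 / Λ ^ 3 - r * √(1 - Θ ^ 2 / G ^ 2) * ecc Λ G * cos g / Λ
    + r * √(1 - Θ ^ 2 / G ^ 2) * cos g * G ^ 2 / (Λ ^ 3 * ecc Λ G)
    + r * √(1 - Θ ^ 2 / G ^ 2) * cos g / Λ * cos ξ
    - 2 * r * √(1 - Θ ^ 2 / G ^ 2) * G * sin g / Λ ^ 2 * sin ξ

/-- The derivative of `bracketNumerator` in the eccentric anomaly. -/
noncomputable def bracketNumeratorDξ (Λ Θ G g r ξ : ℝ) : ℝ :=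
  -(r * √(1 - Θ ^ 2 / G ^ 2) * cos g / Λ * sin ξ)
    - 2 * r * √(1 - Θ ^ 2 / G ^ 2) * G * sin g / Λ ^ 2 * cos ξ

theorem hasDerivAt_bracketNumerator (Λ Θ G g r x : ℝ) :
    HasDerivAt (fun x => bracketNumerator Λ Θ G g r x) (bracketNumeratorDξ Λ Θ G g r x) x := by
  refine ((((hasDerivAt_cos x).const_mul (r * √(1 - Θ ^ 2 / G ^ 2) * cos g / Λ)).const_add
    (r ^ 2 / Λ ^ 3 - r * √(1 - Θ ^ 2 / G ^ 2) * ecc Λ G * cos g / Λ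
      + r * √(1 - Θ ^ 2 / G ^ 2) * cos g * G ^ 2 / (Λ ^ 3 * ecc Λ G))).sub
    ((hasDerivAt_sin x).const_mul
      (2 * r * √(1 - Θ ^ 2 / G ^ 2) * G * sin g / Λ ^ 2))).congr_deriv ?_
  unfold bracketNumeratorDξ
  ring

/-- The derivative of `E₀` in `G`. -/
noncomputable def eulerDG (Λ Θ r G g : ℝ) : ℝ :=
  2 * G + r * (Θ ^ 2 / (G ^ 3 * √(1 - Θ ^ 2 / G ^ 2)) * ecc Λ G
    - √(1 - Θ ^ 2 / G ^ 2) * (G / (Λ ^ 2 * ecc Λ G))) * cos g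

/-- The derivative of `E₀` in `g`. -/
noncomputable def eulerDg (Λ Θ r G g : ℝ) : ℝ :=
  -(r * √(1 - Θ ^ 2 / G ^ 2) * ecc Λ G * sin g)

theorem bracket_identity {Λ Θ G : ℝ} (h0 : |Θ| < G) (h : G < Λ) (g r x : ℝ) :
    (varrhoDG Λ G x * dsq Λ Θ G g r x - varrho Λ G x * dsqDG Λ Θ G g r x / 2)
        * eulerDg Λ Θ r G g
      + varrho Λ G x * dsqDg Λ Θ G g r x / 2 * eulerDG Λ Θ r G g
      = bracketNumeratorDξ Λ Θ G g r x * dsq Λ Θ G g r x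
        - bracketNumerator Λ Θ G g r x * dsqDξ Λ Θ G g r x / 2 := by
  have hG := (abs_nonneg Θ).trans_lt h0
  have hΛ := hG.trans h
  have he := ecc_pos hG h
  have he2' := ecc_sq hG h
  have hs := sqrt_one_sub_div_sq_pos h0
  have hs2 : √(1 - Θ ^ 2 / G ^ 2) ^ 2 = 1 - Θ ^ 2 / G ^ 2 := Real.sq_sqrt (Real.sqrt_pos.1 hs).le
  have hx := sin_sq_add_cos_sq x
  have hg := sin_sq_add_cos_sq g
  unfold varrhoDG dsqDG eulerDg eulerDG dsqDg bracketNumerator bracketNumeratorDξ dsqDξ dsq varrhoDG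
    pker varrho
  generalize ecc Λ G = e at *
  generalize √(1 - Θ ^ 2 / G ^ 2) = s at *
  generalize sin x = S at *
  generalize cos x = c at *
  generalize sin g = sg at *
  generalize cos g = cg at *
  obtain ⟨η, rfl⟩ : ∃ η, G = η * Λ := ⟨G / Λ, by field_simp⟩
  have hη : 0 < η := (pos_iff_pos_of_mul_pos hG).2 hΛ
  have hΘ : Θ ^ 2 = (1 - s ^ 2) * (η * Λ) ^ 2 := by
    rw [hs2]; field_simp; ring
  have he2 : e ^ 2 = 1 - η ^ 2 := by rw [he2']; field_simp
  rw [hΘ]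
  clear hs2 hΘ h0 hG h he2'
  field_simp
  grind

/-- The averaged Newtonian potential U and the Euler integral E₀ Poisson-commute in the
conjugate pair (G,g): ∂U/∂G·∂E₀/∂g − ∂U/∂g·∂E₀/∂G = 0 on the domain 0 < |Θ| < G < Λ. -/
theorem U_E0_poisson_commute
    (Λ Θ r : ℝ) (hΛ : 0 < Λ) (hΘ : 0 < |Θ|) (hr : 0 < r)
    (ξ : ℝ → ℝ → ℝ)
    (hξ : ∀ G, |Θ| < G → G < Λ → ∀ ℓ, ξ G ℓ - ecc Λ G * Real.sin (ξ G ℓ) = ℓ)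
    (hpos : ∀ G g ℓ, |Θ| < G → G < Λ → 0 < dsq Λ Θ G g r (ξ G ℓ))
    (U E₀ : ℝ → ℝ → ℝ)
    (hU : ∀ G g, U G g =
      (1 / (2 * π)) * ∫ ℓ in (0:ℝ)..(2 * π), 1 / Real.sqrt (dsq Λ Θ G g r (ξ G ℓ)))
    (hE₀ : ∀ G g, E₀ G g = G ^ 2
      + r * Real.sqrt (1 - Θ ^ 2 / G ^ 2) * Real.sqrt (1 - G ^ 2 / Λ ^ 2) * Real.cos g) :
    ∀ G g, |Θ| < G → G < Λ →
      deriv (fun G' => U G' g) G * deriv (fun g' => E₀ G g') g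
        - deriv (fun g' => U G g') g * deriv (fun G' => E₀ G' g) G = 0 := by
  intro G g h0 h
  have hinv : ∀ G, |Θ| < G → G < Λ → ∀ x, ξ G (x - ecc Λ G * sin x) = x := fun G h0 h x =>
    have hG := (abs_nonneg Θ).trans_lt h0
    kepler_injective (ecc_pos hG h).le (ecc_lt_one hG h) (hξ G h0 h _)
  have hD : ∀ G g x, |Θ| < G → G < Λ → 0 < dsq Λ Θ G g r x := fun G g x h0 h => by
    simpa only [hinv G h0 h] using hpos G g (x - ecc Λ G * sin x) h0 h
  have hU' : ∀ G g, |Θ| < G → G < Λ → U G g =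
      (1 / (2 * π)) * ∫ x in (0 : ℝ)..(2 * π), varrho Λ G x / √(dsq Λ Θ G g r x) := by
    intro G g h0 h
    have hG := (abs_nonneg Θ).trans_lt h0
    rw [hU, integral_comp_kepler_inverse (ecc_pos hG h).le (ecc_lt_one hG h) (hinv G h0 h)
      (fun x => 1 / √(dsq Λ Θ G g r x))]
    simp only [varrho, one_div_mul_eq_div]
  have hG := (abs_nonneg Θ).trans_lt h0
  have hIoo : G ∈ Ioo |Θ| Λ := ⟨h0, h⟩
  have hcont : ∀ G g, |Θ| < G → G < Λ →
      Continuous fun x => varrho Λ G x / √(dsq Λ Θ G g r x) := fun G g h0 h => by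
    have : ∀ x, √(dsq Λ Θ G g r x) ≠ 0 := fun x => (Real.sqrt_pos.2 (hD G g x h0 h)).ne'
    have h1 : Continuous fun x => varrho Λ G x := by unfold varrho; fun_prop
    have h2 : Continuous fun x => dsq Λ Θ G g r x := by unfold dsq pker; fun_prop
    exact h1.div h2.sqrt this
  have hecc : ContinuousOn (fun q : ℝ × ℝ => ecc Λ q.1) (Ioo |Θ| Λ ×ˢ univ) := by
    unfold ecc; fun_prop
  have hne : ∀ q : ℝ × ℝ, q ∈ Ioo |Θ| Λ ×ˢ univ → q.1 ≠ 0 := fun q hq =>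
    ((abs_nonneg Θ).trans_lt hq.1.1).ne'
  have hsqrt : ContinuousOn (fun q : ℝ × ℝ => √(1 - Θ ^ 2 / q.1 ^ 2)) (Ioo |Θ| Λ ×ˢ univ) := by
    refine (continuousOn_const.sub (continuousOn_const.div (by fun_prop) ?_)).sqrt
    exact fun q hq => pow_ne_zero 2 (hne q hq)
  have hdsq : ContinuousOn (fun q : ℝ × ℝ => dsq Λ Θ q.1 g r q.2) (Ioo |Θ| Λ ×ˢ univ) := by
    unfold dsq pker varrho; fun_prop
  obtain ⟨hcG, hdG⟩ := hasDerivAt_intervalIntegral_of_continuousOn (a := 0) (b := 2 * π)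
    (F := fun G x => varrho Λ G x / √(dsq Λ Θ G g r x))
    (F' := fun G x => varrhoDG Λ G x / √(dsq Λ Θ G g r x)
      - varrho Λ G x * dsqDG Λ Θ G g r x / (2 * √(dsq Λ Θ G g r x) * dsq Λ Θ G g r x))
    isOpen_Ioo hIoo (fun y hy => hcont y g hy.1 hy.2)
    (by
      have he' : ∀ q : ℝ × ℝ, q ∈ Ioo |Θ| Λ ×ˢ univ → Λ ^ 2 * ecc Λ q.1 ≠ 0 := fun q hq =>
        mul_ne_zero (by positivity) (ecc_pos ((abs_nonneg Θ).trans_lt hq.1.1) hq.1.2).ne'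
      have hs' : ∀ q : ℝ × ℝ, q ∈ Ioo |Θ| Λ ×ˢ univ →
          q.1 ^ 3 * √(1 - Θ ^ 2 / q.1 ^ 2) ≠ 0 := fun q hq =>
        mul_ne_zero (pow_ne_zero 3 (hne q hq)) (sqrt_one_sub_div_sq_pos hq.1.1).ne'
      have h1 : ContinuousOn (fun q : ℝ × ℝ => q.1 / (Λ ^ 2 * ecc Λ q.1)) (Ioo |Θ| Λ ×ˢ univ) :=
        ContinuousOn.div (by fun_prop) (by fun_prop) he'
      have h2 : ContinuousOn (fun q : ℝ × ℝ => Θ ^ 2 / (q.1 ^ 3 * √(1 - Θ ^ 2 / q.1 ^ 2)))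
          (Ioo |Θ| Λ ×ˢ univ) := ContinuousOn.div (by fun_prop) (by fun_prop) hs'
      have h3 : ∀ q : ℝ × ℝ, q ∈ Ioo |Θ| Λ ×ˢ univ → 0 < dsq Λ Θ q.1 g r q.2 := fun q hq =>
        hD _ _ _ hq.1.1 hq.1.2
      have h4 : ContinuousOn (fun q : ℝ × ℝ => varrhoDG Λ q.1 q.2) (Ioo |Θ| Λ ×ˢ univ) := by
        unfold varrhoDG; fun_prop
      have h5 : ContinuousOn (fun q : ℝ × ℝ => varrho Λ q.1 q.2) (Ioo |Θ| Λ ×ˢ univ) := by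
        unfold varrho; fun_prop
      have h6 : ContinuousOn (fun q : ℝ × ℝ => dsqDG Λ Θ q.1 g r q.2) (Ioo |Θ| Λ ×ˢ univ) := by
        unfold dsqDG pker; fun_prop
      refine (h4.div hdsq.sqrt fun q hq => ?_).sub
        ((h5.mul h6).div ((hdsq.sqrt.const_mul 2).mul hdsq) fun q hq => ?_)
      · exact (Real.sqrt_pos.2 (h3 q hq)).ne'
      · have := h3 q hq
        exact (mul_pos (mul_pos two_pos (Real.sqrt_pos.2 this)) this).ne')
    (fun y hy x => (hasDerivAt_varrho_G ((abs_nonneg Θ).trans_lt hy.1) hy.2 x).div_sqrt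
      (hasDerivAt_dsq_G hy.1 hy.2 g r x) (hD y g x hy.1 hy.2))
  obtain ⟨hcg, hdg⟩ := hasDerivAt_intervalIntegral_of_continuousOn (a := 0) (b := 2 * π)
    (F := fun g x => varrho Λ G x / √(dsq Λ Θ G g r x))
    (F' := fun g x => 0 / √(dsq Λ Θ G g r x)
      - varrho Λ G x * dsqDg Λ Θ G g r x / (2 * √(dsq Λ Θ G g r x) * dsq Λ Θ G g r x))
    isOpen_univ (mem_univ g) (fun y _ => hcont G y h0 h)
    (by
      have h3 : ∀ q : ℝ × ℝ, 0 < dsq Λ Θ G q.1 r q.2 := fun q => hD _ _ _ h0 h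
      have h4 : Continuous (fun q : ℝ × ℝ => dsq Λ Θ G q.1 r q.2) := by
        unfold dsq pker varrho; fun_prop
      have h5 : Continuous (fun q : ℝ × ℝ => varrho Λ G q.2 * dsqDg Λ Θ G q.1 r q.2) := by
        unfold dsqDg varrho; fun_prop
      simp only [zero_div]
      refine (continuous_const.sub
        (h5.div ((h4.sqrt.const_mul 2).mul h4) fun q => ?_)).continuousOn
      exact (mul_pos (mul_pos two_pos (Real.sqrt_pos.2 (h3 q))) (h3 q)).ne')
    (fun y _ x => (hasDerivAt_const y (varrho Λ G x)).div_sqrt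
      (hasDerivAt_dsq_g Λ Θ G y r x) (hD G y x h0 h))
  have hUG := ((hdG.const_mul (1 / (2 * π))).congr_of_eventuallyEq (f₁ := fun G => U G g) (by
    filter_upwards [isOpen_Ioo.mem_nhds hIoo] with G' hG' using hU' G' g hG'.1 hG'.2)).deriv
  have hUg := ((hdg.const_mul (1 / (2 * π))).congr_of_eventuallyEq (f₁ := fun g => U G g)
    (Eventually.of_forall fun g' => hU' G g' h0 h)).deriv
  have hEG : deriv (fun G' => E₀ G' g) G = eulerDG Λ Θ r G g := by
    simp only [hE₀]
    refine ((hasDerivAt_pow 2 G).add ((((hasDerivAt_sqrt_one_sub_div_sq h0).const_mul r).mul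
      (hasDerivAt_ecc hG h)).mul_const (cos g))).deriv.trans ?_
    unfold eulerDG
    push_cast
    ring
  have hEg : deriv (fun g' => E₀ G g') g = eulerDg Λ Θ r G g := by
    simp only [hE₀]
    refine (((hasDerivAt_cos g).const_mul
      (r * √(1 - Θ ^ 2 / G ^ 2) * ecc Λ G)).const_add (G ^ 2)).deriv.trans ?_
    unfold eulerDg
    ring
  have hW : ∀ x, HasDerivAt (fun x => bracketNumerator Λ Θ G g r x / √(dsq Λ Θ G g r x))
      ((varrhoDG Λ G x / √(dsq Λ Θ G g r x)
          - varrho Λ G x * dsqDG Λ Θ G g r x / (2 * √(dsq Λ Θ G g r x) * dsq Λ Θ G g r x))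
        * eulerDg Λ Θ r G g
      - (0 / √(dsq Λ Θ G g r x)
          - varrho Λ G x * dsqDg Λ Θ G g r x / (2 * √(dsq Λ Θ G g r x) * dsq Λ Θ G g r x))
        * eulerDG Λ Θ r G g) x := fun x => by
    have hDx := hD G g x h0 h
    have hsx := Real.sqrt_pos.2 hDx
    refine ((hasDerivAt_bracketNumerator Λ Θ G g r x).div_sqrt
      (hasDerivAt_dsq_ξ Λ Θ G g r x) hDx).congr_deriv ?_
    have key := bracket_identity h0 h g r x
    generalize √(dsq Λ Θ G g r x) = w at *
    generalize dsq Λ Θ G g r x = D at *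
    field_simp
    linear_combination (-2) * key
  have hint := intervalIntegral.integral_eq_sub_of_hasDerivAt (a := 0) (b := 2 * π)
    (fun x _ => hW x)
    (((hcG.intervalIntegrable _ _).mul_const _).sub ((hcg.intervalIntegrable _ _).mul_const _))
  rw [intervalIntegral.integral_sub ((hcG.intervalIntegrable _ _).mul_const _)
    ((hcg.intervalIntegrable _ _).mul_const _), intervalIntegral.integral_mul_const,
    intervalIntegral.integral_mul_const] at hint
  have hper : bracketNumerator Λ Θ G g r (2 * π) / √(dsq Λ Θ G g r (2 * π))
      = bracketNumerator Λ Θ G g r 0 / √(dsq Λ Θ G g r 0) := by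
    simp [bracketNumerator, dsq, pker, varrho]
  rw [hper, sub_self] at hint
  rw [hUG, hUg, hEG, hEg]
  linear_combination (1 / (2 * π)) * hint
end
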